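/- Let p(x_V) be a distribution that obeys the global nested Markov property with respect to an ADMG 𝒢(V). If u and w are two valid fixing sequences for the same set W ⊂ V, then φ_u(𝒢) = φ_w(𝒢) and φ_u(p(x_V); 𝒢) = φ_w(p(x_V); 𝒢); that is, the reached graph and kernel depend only on the set of fixed vertices, not on the order of fixing. -/

import Mathlib

open scoped Classical
open Finset

namespace Nested

/-- A directed mixed graph: directed (`dir`) and bidirected (`bi`) edges. -/
structure MixedGraph (Vt : Type) where
  dir : Vt → Vt → Prop
  bi : Vt → Vt → Prop

/-- A step along a path: an edge traversed from `src` to `tgt`, with Booleans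
recording whether there is an arrowhead at the `src` (resp. `tgt`) end. -/
structure Step (Vt : Type) where
  src : Vt
  tgt : Vt
  hsrc : Bool
  htgt : Bool

/-- The step corresponds to an actual edge of the mixed graph `M`. -/
def StepIn {Vt : Type} (M : MixedGraph Vt) (s : Step Vt) : Prop :=
  (s.hsrc = false ∧ s.htgt = true ∧ M.dir s.src s.tgt) ∨
  (s.hsrc = true ∧ s.htgt = false ∧ M.dir s.tgt s.src) ∨
  (s.hsrc = true ∧ s.htgt = true ∧ M.bi s.src s.tgt)

/-- `IsWalk M a p b`: `p` is a walk in `M` from `a` to `b`. -/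
def IsWalk {Vt : Type} (M : MixedGraph Vt) : Vt → List (Step Vt) → Vt → Prop
  | a, [], b => a = b
  | a, s :: p, b => s.src = a ∧ StepIn M s ∧ IsWalk M s.tgt p b

/-- The list of vertices visited by a walk starting at `a`. -/
def wverts {Vt : Type} (a : Vt) (p : List (Step Vt)) : List Vt :=
  a :: p.map Step.tgt

/-- The non-endpoint (interior) vertices of a walk. -/
def interiorVerts {Vt : Type} (p : List (Step Vt)) : List Vt :=
  (p.map Step.tgt).dropLast

variable {Vt : Type} [Fintype Vt] [DecidableEq Vt]

/-- `z` is an ancestor (via directed edges) of some element of `C`. -/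
def ancOf (M : MixedGraph Vt) (C : Finset Vt) (z : Vt) : Prop :=
  ∃ c ∈ C, Relation.ReflTransGen M.dir z c

/-- The common vertex of two consecutive steps is a collider. -/
def Collider {Vt : Type} (s t : Step Vt) : Prop := s.htgt = true ∧ t.hsrc = true

/-- The interior vertex shared by consecutive steps `s`, `t` satisfies the
m-connection requirement given `C`: colliders are ancestors of `C`,
non-colliders lie outside `C`. -/
def jointOK (M : MixedGraph Vt) (C : Finset Vt) (s t : Step Vt) : Prop :=
  (Collider s t ∧ ancOf M C s.tgt) ∨ (¬ Collider s t ∧ s.tgt ∉ C)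

/-- `a` and `b` are m-connected given `C` in `M`: there is a path (walk with
distinct vertices) from `a` to `b` every non-collider of which avoids `C` and
every collider of which is an ancestor of `C`. -/
def MConn (M : MixedGraph Vt) (C : Finset Vt) (a b : Vt) : Prop :=
  ∃ p : List (Step Vt), IsWalk M a p b ∧ (wverts a p).Nodup ∧
    List.Chain' (jointOK M C) p

/-- m-separation of the sets `A` and `B` given `C` in `M`. -/
def MSep (M : MixedGraph Vt) (A B C : Finset Vt) : Prop :=
  ∀ a ∈ A, ∀ b ∈ B, ¬ MConn M C a b

/-- There is a directed path from `v` to `w` in `M` all of whose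
non-endpoint vertices lie in `L`. -/
def DirVia (M : MixedGraph Vt) (L : Finset Vt) (v w : Vt) : Prop :=
  ∃ p : List (Step Vt), p ≠ [] ∧ IsWalk M v p w ∧ (wverts v p).Nodup ∧
    (∀ s ∈ p, s.hsrc = false ∧ s.htgt = true) ∧
    (∀ z ∈ interiorVerts p, z ∈ L)

/-- There is a path between `v` and `w` in `M` with arrowheads at both
endpoints, all of whose non-endpoint vertices are non-colliders lying in `L`. -/
def BiVia (M : MixedGraph Vt) (L : Finset Vt) (v w : Vt) : Prop :=
  ∃ p : List (Step Vt), p ≠ [] ∧ IsWalk M v p w ∧ (wverts v p).Nodup ∧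
    (∀ s, p.head? = some s → s.hsrc = true) ∧
    (∀ s, p.getLast? = some s → s.htgt = true) ∧
    (∀ z ∈ interiorVerts p, z ∈ L) ∧
    List.Chain' (fun s t => ¬ Collider s t) p

/-- A (pre-)conditional acyclic directed mixed graph: a mixed graph together
with disjoint finite sets `V` of random and `W` of fixed vertices.  The
well-formedness conditions are collected in `PreCADMG.WF`. -/
structure PreCADMG (Vt : Type) where
  dir : Vt → Vt → Prop
  bi : Vt → Vt → Prop
  V : Finset Vt
  W : Finset Vt

/-- The underlying mixed graph of a CADMG. -/
def PreCADMG.mg {Vt : Type} (G : PreCADMG Vt) : MixedGraph Vt := ⟨G.dir, G.bi⟩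

/-- Well-formedness: `V` and `W` are disjoint, `bi` is symmetric, all edges
join vertices of `V ∪ W`, directed and bidirected edges never point into `W`,
and there are no directed cycles.  (So `WF` with `W = ∅` says: ADMG.) -/
def PreCADMG.WF {Vt : Type} (G : PreCADMG Vt) : Prop :=
  Disjoint G.V G.W ∧
  (∀ a b, G.bi a b → G.bi b a) ∧
  (∀ a b, G.dir a b → a ∈ G.V ∪ G.W ∧ b ∈ G.V) ∧
  (∀ a b, G.bi a b → a ∈ G.V ∧ b ∈ G.V) ∧
  (∀ v, ¬ Relation.TransGen G.dir v v)

/-- The district of `v`: random vertices joined to `v` by a bidirected path. -/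
noncomputable def dis (G : PreCADMG Vt) (v : Vt) : Finset Vt :=
  G.V.filter (fun w => Relation.ReflTransGen G.bi v w)

/-- The set of districts of `G`. -/
noncomputable def districts (G : PreCADMG Vt) : Finset (Finset Vt) :=
  G.V.image (dis G)

/-- Descendants of `v` (including `v` itself, among the vertices of `G`). -/
noncomputable def deF (G : PreCADMG Vt) (v : Vt) : Finset Vt :=
  (G.V ∪ G.W).filter (fun w => Relation.ReflTransGen G.dir v w)

/-- Non-descendants of `v`. -/
noncomputable def ndF (G : PreCADMG Vt) (v : Vt) : Finset Vt :=
  (G.V ∪ G.W) \ deF G v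

/-- Ancestors of the set `D` (including `D`). -/
noncomputable def anS (G : PreCADMG Vt) (D : Finset Vt) : Finset Vt :=
  (G.V ∪ G.W).filter (fun a => ∃ d ∈ D, Relation.ReflTransGen G.dir a d)

/-- Parents of the set `D`. -/
noncomputable def paS (G : PreCADMG Vt) (D : Finset Vt) : Finset Vt :=
  (G.V ∪ G.W).filter (fun a => ∃ d ∈ D, G.dir a d)

/-- Markov blanket: `mb(t) = pa(dis(t)) ∪ (dis(t) \ {t})`. -/
noncomputable def mb (G : PreCADMG Vt) (t : Vt) : Finset Vt :=
  paS G (dis G t) ∪ (dis G t).erase t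

/-- `v` is fixable in `G`: `v` is random and `dis(v) ∩ de(v) = {v}`. -/
def fixable (G : PreCADMG Vt) (v : Vt) : Prop :=
  v ∈ G.V ∧ dis G v ∩ deF G v = {v}

/-- The set `𝔽(G)` of fixable vertices. -/
noncomputable def FixF (G : PreCADMG Vt) : Finset Vt :=
  G.V.filter (fun v => fixable G v)

/-- The graph `φ_r(G)`:  `r` becomes fixed and edges with an arrowhead at `r`
are deleted. -/
def fixG (G : PreCADMG Vt) (r : Vt) : PreCADMG Vt where
  dir a b := G.dir a b ∧ b ≠ r
  bi a b := G.bi a b ∧ a ≠ r ∧ b ≠ r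
  V := G.V.erase r
  W := insert r G.W

/-- The induced subgraph on `A`, preserving random/fixed status. -/
def induce (G : PreCADMG Vt) (A : Finset Vt) : PreCADMG Vt where
  dir a b := G.dir a b ∧ a ∈ A ∧ b ∈ A
  bi a b := G.bi a b ∧ a ∈ A ∧ b ∈ A
  V := G.V ∩ A
  W := G.W ∩ A

/-- `A` is an ancestral set in `G`. -/
def Ancestral (G : PreCADMG Vt) (A : Finset Vt) : Prop :=
  A ⊆ G.V ∪ G.W ∧
  ∀ a ∈ A, ∀ b ∈ G.V ∪ G.W, Relation.ReflTransGen G.dir b a → b ∈ A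

/-- `ord` is (the rank function of) a topological total ordering for `G`:
if `a ≺ b` then `a` is not a descendant of `b`. -/
def IsTopo (G : PreCADMG Vt) (ord : Vt → ℕ) : Prop :=
  Function.Injective ord ∧
  ∀ a b, ord a < ord b → ¬ Relation.ReflTransGen G.dir b a

/-- The predecessors of `d` in the ordering `ord`. -/
noncomputable def preF (G : PreCADMG Vt) (ord : Vt → ℕ) (d : Vt) : Finset Vt :=
  (G.V ∪ G.W).filter (fun a => ord a < ord d)

/-- The graph `G^{|W}`: all pairs of fixed vertices joined by bidirected
edges. -/
def augMG (G : PreCADMG Vt) : MixedGraph Vt :=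
  ⟨G.dir, fun a b => G.bi a b ∨ (a ∈ G.W ∧ b ∈ G.W ∧ a ≠ b)⟩

/-- Adjacency in the augmented graph `(G)^a`: joined in `G^{|W}` by a path on
which every non-endpoint vertex is a collider. -/
def augEdge (G : PreCADMG Vt) (a b : Vt) : Prop :=
  a ≠ b ∧ ∃ p : List (Step Vt), p ≠ [] ∧ IsWalk (augMG G) a p b ∧
    (wverts a p).Nodup ∧ List.Chain' Collider p

/-- Undirected separation of `a` from `b` by `C` (w.r.t. adjacency `E`). -/
def USepPt (E : Vt → Vt → Prop) (C : Finset Vt) (a b : Vt) : Prop :=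
  ∀ l : List Vt, l.Chain' E → l.head? = some a → l.getLast? = some b →
    l.Nodup → ∃ v ∈ l, v ∈ C

/-- Undirected separation of `A` from `B` by `C`. -/
def USep (E : Vt → Vt → Prop) (C A B : Finset Vt) : Prop :=
  ∀ a ∈ A, ∀ b ∈ B, USepPt E C a b

/-- The latent projection of `G` obtained by projecting out the (random)
vertices in `H`. -/
def project (G : PreCADMG Vt) (H : Finset Vt) : PreCADMG Vt where
  dir v w := v ∈ (G.V \ H) ∪ G.W ∧ w ∈ G.V \ H ∧ v ≠ w ∧ DirVia G.mg H v w
  bi v w := v ∈ G.V \ H ∧ w ∈ G.V \ H ∧ v ≠ w ∧ BiVia G.mg H v w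
  V := G.V \ H
  W := G.W

/-! ## Kernels -/

variable {𝔛 : Vt → Type} [∀ v, Fintype (𝔛 v)]

/-- Sum a function of a joint state over all assignments to the coordinates in
`S`, the remaining coordinates being given by `x`. -/
noncomputable def sumOver (S : Finset Vt) (f : (∀ v, 𝔛 v) → ℝ) (x : ∀ v, 𝔛 v) : ℝ :=
  ∑ y : ((v : {v : Vt // v ∈ S}) → 𝔛 v.1),
    f (fun v => if h : v ∈ S then y ⟨v, h⟩ else x v)

/-- `f` depends only on the coordinates in `S`. -/
def DepOn (f : (∀ v, 𝔛 v) → ℝ) (S : Finset Vt) : Prop :=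
  ∀ x y : ∀ v, 𝔛 v, (∀ v ∈ S, x v = y v) → f x = f y

/-- `q` is a kernel `q_V(x_V | x_W)`: a nonnegative function of `(x_V, x_W)`
with `∑_{x_V} q_V(x_V | x_W) = 1` for every `x_W`. -/
def IsKernel (V W : Finset Vt) (q : (∀ v, 𝔛 v) → ℝ) : Prop :=
  (∀ x, 0 ≤ q x) ∧ DepOn q (V ∪ W) ∧ ∀ x, sumOver V q x = 1

/-- Case (a) of the definition of kernel conditional independence
`X_A ⫫ X_B | X_C [q_V]`:  `A ∩ W = ∅` and the conditional kernel
`q_V(x_A | x_B, x_C, x_{W∖(B∪C)})` is, wherever defined, a function of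
`x_A, x_C` only. -/
def KIndepA (V W : Finset Vt) (q : (∀ v, 𝔛 v) → ℝ) (A B C : Finset Vt) : Prop :=
  A ∩ W = ∅ ∧
  ∀ x y : ∀ v, 𝔛 v, (∀ v ∈ A ∪ C, x v = y v) →
    0 < sumOver (V \ (B ∪ C)) q x → 0 < sumOver (V \ (B ∪ C)) q y →
    sumOver (V \ (A ∪ B ∪ C)) q x / sumOver (V \ (B ∪ C)) q x =
      sumOver (V \ (A ∪ B ∪ C)) q y / sumOver (V \ (B ∪ C)) q y

/-- Kernel conditional independence `X_A ⫫ X_B | X_C [q_V]`. -/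
def KIndep (V W : Finset Vt) (q : (∀ v, 𝔛 v) → ℝ) (A B C : Finset Vt) : Prop :=
  KIndepA V W q A B C ∨ KIndepA V W q B A C

/-- The conditional kernel `q_V(x_d | x_T)` (as a function of the joint
state). -/
noncomputable def condOn (V : Finset Vt) (q : (∀ v, 𝔛 v) → ℝ) (d : Vt)
    (T : Finset Vt) : (∀ v, 𝔛 v) → ℝ :=
  fun x => sumOver (V \ insert d T) q x / sumOver (V \ T) q x

/-- The kernel `q*_{V∖H} = q_V / q_V(x_H | x_T, x_W)` obtained by fixing `H`. -/
noncomputable def qstar (V H T : Finset Vt) (q : (∀ v, 𝔛 v) → ℝ) :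
    (∀ v, 𝔛 v) → ℝ :=
  fun x => q x / (sumOver (V \ (H ∪ T)) q x / sumOver (V \ T) q x)

/-- The kernel fixing operation `φ_r(q; G) = q / q_V(x_r | x_{mb_G(r)})`. -/
noncomputable def fixK (G : PreCADMG Vt) (r : Vt) (q : (∀ v, 𝔛 v) → ℝ) :
    (∀ v, 𝔛 v) → ℝ :=
  fun x => q x / condOn G.V q r (mb G r) x

/-- The global Markov property for a CADMG (`q ∈ 𝒫^c_m(G)`). -/
def Pcm (G : PreCADMG Vt) (q : (∀ v, 𝔛 v) → ℝ) : Prop :=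
  ∀ A B C : Finset Vt, A ⊆ G.V ∪ G.W → B ⊆ G.V ∪ G.W → C ⊆ G.V ∪ G.W →
    Disjoint A B → Disjoint A C → Disjoint B C →
    MSep (augMG G) A B C → KIndep G.V G.W q A B C

/-- The augmented Markov property for a CADMG (`q ∈ 𝒫^c_a(G)`). -/
def Pca (G : PreCADMG Vt) (q : (∀ v, 𝔛 v) → ℝ) : Prop :=
  ∀ A B C : Finset Vt, A ⊆ G.V ∪ G.W → B ⊆ G.V ∪ G.W → C ⊆ G.V ∪ G.W →
    Disjoint A B → Disjoint A C → Disjoint B C →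
    USep (augEdge (induce G (anS G (A ∪ B ∪ C)))) C A B →
    KIndep G.V G.W q A B C

/-- The local Markov property for `G` at `t`. -/
def LocalAt (G : PreCADMG Vt) (q : (∀ v, 𝔛 v) → ℝ) (t : Vt) : Prop :=
  KIndep G.V G.W q {t} ((G.V ∪ G.W) \ insert t (mb G t)) (mb G t)

/-- The ordered local Markov property for a CADMG (`q ∈ 𝒫^c_l(G, ≺)`). -/
def Pcl (G : PreCADMG Vt) (ord : Vt → ℕ) (q : (∀ v, 𝔛 v) → ℝ) : Prop :=
  ∀ A : Finset Vt, Ancestral G A → ∀ m ∈ A, (∀ a ∈ A, ord a ≤ ord m) →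
    m ∈ G.V →
    LocalAt (induce G ((G.V ∩ A) ∪ G.W)) (sumOver (G.V \ A) q) m

/-- Tian factorization for a CADMG (`q ∈ 𝒫^c_f(G)`). -/
def Pcf (G : PreCADMG Vt) (q : (∀ v, 𝔛 v) → ℝ) : Prop :=
  ∀ A : Finset Vt, Ancestral G A →
    ∃ f : Finset Vt → ((∀ v, 𝔛 v) → ℝ),
      (∀ D ∈ districts (induce G A), IsKernel D (paS G D \ D) (f D)) ∧
      ∀ x, sumOver (G.V \ A) q x = ∏ D ∈ districts (induce G A), f D x

/-- `T^{(d,D)}_≺ = mb_G(d, an_G(D) ∩ pre_≺(d))`. -/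
noncomputable def Tset (G : PreCADMG Vt) (ord : Vt → ℕ) (d : Vt)
    (D : Finset Vt) : Finset Vt :=
  mb (induce G (insert d (anS G D ∩ preF G ord d))) d

/-- The district kernel
`q_D(x_D | x_{pa(D)∖D}) = ∏_{d ∈ D} q_V(x_d | x_{T^{(d,D)}_≺})`. -/
noncomputable def qD (G : PreCADMG Vt) (ord : Vt → ℕ)
    (q : (∀ v, 𝔛 v) → ℝ) (D : Finset Vt) : (∀ v, 𝔛 v) → ℝ :=
  fun x => ∏ d ∈ D, condOn G.V q d (Tset G ord d D) x

/-! ## Fixing sequences and nested Markov properties -/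

/-- Iterated graph fixing. -/
def fixGs : PreCADMG Vt → List Vt → PreCADMG Vt
  | G, [] => G
  | G, r :: rs => fixGs (fixG G r) rs

/-- Iterated kernel fixing. -/
noncomputable def fixKs : PreCADMG Vt → ((∀ v, 𝔛 v) → ℝ) → List Vt →
    ((∀ v, 𝔛 v) → ℝ)
  | _, q, [] => q
  | G, q, r :: rs => fixKs (fixG G r) (fixK G r q) rs

/-- A valid fixing sequence: each vertex is fixable when its turn comes. -/
def ValidSeq : PreCADMG Vt → List Vt → Prop
  | _, [] => True
  | G, r :: rs => fixable G r ∧ ValidSeq (fixG G r) rs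

/-- The global nested Markov property for an ADMG. -/
def NestedGlobal (G : PreCADMG Vt) (p : (∀ v, 𝔛 v) → ℝ) : Prop :=
  ∀ ws : List Vt, ValidSeq G ws → Pcm (fixGs G ws) (fixKs G p ws)

/-- `C` is intrinsic in `G`: a district of a reachable CADMG. -/
def Intrinsic (G : PreCADMG Vt) (C : Finset Vt) : Prop :=
  ∃ ws : List Vt, ws.Nodup ∧ ValidSeq G ws ∧ C ∈ districts (fixGs G ws)

/-- The ordered local nested Markov property for an ADMG. -/
def NestedLocal (G : PreCADMG Vt) (ord : Vt → ℕ) (p : (∀ v, 𝔛 v) → ℝ) : Prop :=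
  ∀ C : Finset Vt, Intrinsic G C →
    ∀ ws : List Vt, ws.Nodup → ValidSeq G ws → ws.toFinset = G.V \ C →
      ∀ m ∈ C, (∀ c ∈ C, ord c ≤ ord m) →
        LocalAt (fixGs G ws) (fixKs G p ws) m

end Nested

namespace Nested

section Sums

variable {Vt : Type} [DecidableEq Vt] {𝔛 : Vt → Type} [∀ v, Fintype (𝔛 v)]

lemma sumOver_const_mul (S : Finset Vt) (c : ℝ) (f : (∀ v, 𝔛 v) → ℝ) (x : ∀ v, 𝔛 v) :
    sumOver S (fun y => c * f y) x = c * sumOver S f x := by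
  rw [sumOver, sumOver, Finset.mul_sum]

lemma sumOver_nonneg {f : (∀ v, 𝔛 v) → ℝ} (hf : ∀ x, 0 ≤ f x) (S : Finset Vt)
    (x : ∀ v, 𝔛 v) : 0 ≤ sumOver S f x :=
  Finset.sum_nonneg fun _ _ => hf _

variable [Fintype Vt]

/-- Summing over the coordinates in `S` is summing over the states that agree with `x` off `S`. -/
lemma sumOver_eq_sum_filter (S : Finset Vt) (f : (∀ v, 𝔛 v) → ℝ) (x : ∀ v, 𝔛 v) :
    sumOver S f x = ∑ y with (∀ v, v ∉ S → y v = x v), f y := by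
  unfold sumOver
  refine Finset.sum_bij' (fun y _ v => if h : v ∈ S then y ⟨v, h⟩ else x v)
    (fun z _ v => z v.1) ?_ ?_ ?_ ?_ ?_
  · intro y _
    simp only [mem_filter, mem_univ, true_and]
    intro v hv
    simp [hv]
  · intro z _
    simp
  · intro y _
    funext v
    simp
  · intro z hz
    simp only [mem_filter, mem_univ, true_and] at hz
    funext v
    by_cases h : v ∈ S
    · simp [h]
    · simp [h, hz v h]
  · intro y _
    rfl

lemma sumOver_congr_off {S : Finset Vt} (f : (∀ v, 𝔛 v) → ℝ) {x y : ∀ v, 𝔛 v}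
    (h : ∀ v, v ∉ S → x v = y v) : sumOver S f x = sumOver S f y := by
  rw [sumOver_eq_sum_filter, sumOver_eq_sum_filter]
  refine Finset.sum_congr ?_ fun _ _ => rfl
  ext z
  simp only [mem_filter, mem_univ, true_and]
  exact forall₂_congr fun v hv => by rw [h v hv]

lemma sumOver_congr {S : Finset Vt} {f g : (∀ v, 𝔛 v) → ℝ} {x : ∀ v, 𝔛 v}
    (h : ∀ y, (∀ v, v ∉ S → y v = x v) → f y = g y) : sumOver S f x = sumOver S g x := by
  rw [sumOver_eq_sum_filter, sumOver_eq_sum_filter]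
  refine Finset.sum_congr rfl fun y hy => h y ?_
  simpa using hy

lemma sumOver_empty (f : (∀ v, 𝔛 v) → ℝ) (x : ∀ v, 𝔛 v) : sumOver ∅ f x = f x := by
  rw [sumOver_eq_sum_filter]
  have : (univ.filter fun y : ∀ v, 𝔛 v => ∀ v, v ∉ (∅ : Finset Vt) → y v = x v) = {x} := by
    ext y
    simp [funext_iff]
  rw [this, Finset.sum_singleton]

lemma sumOver_union {S T : Finset Vt} (hST : Disjoint S T) (f : (∀ v, 𝔛 v) → ℝ)
    (x : ∀ v, 𝔛 v) : sumOver (S ∪ T) f x = sumOver S (sumOver T f) x := by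
  simp only [sumOver_eq_sum_filter]
  rw [← Finset.sum_fiberwise_of_maps_to
    (t := univ.filter fun y : ∀ v, 𝔛 v => ∀ v, v ∉ S → y v = x v)
    (g := fun y v => if v ∈ S then y v else x v)]
  · refine Finset.sum_congr rfl fun z hz => ?_
    simp only [mem_filter, mem_univ, true_and] at hz
    refine Finset.sum_congr ?_ fun _ _ => rfl
    ext y
    simp only [mem_filter, mem_univ, true_and, mem_union, not_or, funext_iff]
    constructor
    · rintro ⟨h1, h2⟩ v hv
      by_cases hS : v ∈ S
      · simpa [hS] using h2 v
      · rw [h1 v ⟨hS, hv⟩, hz v hS]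
    · intro h
      refine ⟨fun v hv => by rw [h v hv.2, hz v hv.1], fun v => ?_⟩
      by_cases hS : v ∈ S
      · simpa [hS] using h v (Finset.disjoint_left.mp hST hS)
      · simp [hS, hz v hS]
  · intro y _
    simp only [mem_filter, mem_univ, true_and]
    intro v hv
    simp [hv]

lemma sumOver_pos_iff {f : (∀ v, 𝔛 v) → ℝ} (hf : ∀ x, 0 ≤ f x) {S : Finset Vt}
    {x : ∀ v, 𝔛 v} :
    0 < sumOver S f x ↔ ∃ y, (∀ v, v ∉ S → y v = x v) ∧ 0 < f y := by
  rw [sumOver_eq_sum_filter, Finset.sum_pos_iff_of_nonneg fun _ _ => hf _]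
  simp

lemma sumOver_pos_mono {f : (∀ v, 𝔛 v) → ℝ} (hf : ∀ x, 0 ≤ f x) {S T : Finset Vt}
    (hST : S ⊆ T) {x : ∀ v, 𝔛 v} (h : 0 < sumOver S f x) : 0 < sumOver T f x := by
  rw [sumOver_pos_iff hf] at h ⊢
  obtain ⟨y, hy, hpos⟩ := h
  exact ⟨y, fun v hv => hy v fun h => hv (hST h), hpos⟩

lemma sumOver_pos_of_pos {f : (∀ v, 𝔛 v) → ℝ} (hf : ∀ x, 0 ≤ f x) (S : Finset Vt)
    {x : ∀ v, 𝔛 v} (h : 0 < f x) : 0 < sumOver S f x :=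
  (sumOver_pos_iff hf).mpr ⟨x, fun _ _ => rfl, h⟩

/-- Conditional independence as a product identity between marginals. -/
lemma KIndepA.mul_eq_mul {V W A B C : Finset Vt} {q : (∀ v, 𝔛 v) → ℝ} (hq : ∀ x, 0 ≤ q x)
    (hAB : Disjoint A B) (hBC : Disjoint B C) (h : KIndepA V W q A B C) (x : ∀ v, 𝔛 v) :
    sumOver (V \ (A ∪ B ∪ C)) q x * sumOver (V \ C) q x =
      sumOver (V \ (B ∪ C)) q x * sumOver (V \ (A ∪ C)) q x := by
  have hnum : ∀ y, ¬ 0 < sumOver (V \ (B ∪ C)) q y → sumOver (V \ (A ∪ B ∪ C)) q y = 0 := by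
    intro y hy
    by_contra hne
    refine hy (sumOver_pos_mono hq ?_ (lt_of_le_of_ne (sumOver_nonneg hq _ _) (Ne.symm hne)))
    grind
  by_cases hx : 0 < sumOver (V \ (B ∪ C)) q x
  · have e1 : V \ (A ∪ C) = (V ∩ B) ∪ (V \ (A ∪ B ∪ C)) := by
      ext v
      have : v ∈ A → v ∉ B := fun h => Finset.disjoint_left.mp hAB h
      have : v ∈ B → v ∉ C := fun h => Finset.disjoint_left.mp hBC h
      grind
    have e2 : V \ C = (V ∩ B) ∪ (V \ (B ∪ C)) := by
      ext v
      have : v ∈ B → v ∉ C := fun h => Finset.disjoint_left.mp hBC h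
      grind
    have d1 : Disjoint (V ∩ B) (V \ (A ∪ B ∪ C)) := Finset.disjoint_left.mpr (by grind)
    have d2 : Disjoint (V ∩ B) (V \ (B ∪ C)) := Finset.disjoint_left.mpr (by grind)
    have key : sumOver (V \ (A ∪ C)) q x =
        sumOver (V \ (A ∪ B ∪ C)) q x / sumOver (V \ (B ∪ C)) q x * sumOver (V \ C) q x := by
      rw [e1, e2, sumOver_union d1, sumOver_union d2, ← sumOver_const_mul]
      refine sumOver_congr fun y hy => ?_
      by_cases hy0 : 0 < sumOver (V \ (B ∪ C)) q y
      · rw [h.2 x y ?_ hx hy0, div_mul_cancel₀ _ hy0.ne']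
        intro v hv
        refine (hy v fun hvB => ?_).symm
        have : v ∈ A → v ∉ B := fun h => Finset.disjoint_left.mp hAB h
        have : v ∈ B → v ∉ C := fun h => Finset.disjoint_left.mp hBC h
        grind
      · rw [hnum y hy0, le_antisymm (not_lt.mp hy0) (sumOver_nonneg hq _ _), mul_zero]
    rw [key]
    field_simp
  · rw [hnum x hx, le_antisymm (not_lt.mp hx) (sumOver_nonneg hq _ _), zero_mul, zero_mul]

lemma KIndep.mul_eq_mul {V W A B C : Finset Vt} {q : (∀ v, 𝔛 v) → ℝ} (hq : ∀ x, 0 ≤ q x)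
    (hAB : Disjoint A B) (hAC : Disjoint A C) (hBC : Disjoint B C) (h : KIndep V W q A B C)
    (x : ∀ v, 𝔛 v) :
    sumOver (V \ (A ∪ B ∪ C)) q x * sumOver (V \ C) q x =
      sumOver (V \ (B ∪ C)) q x * sumOver (V \ (A ∪ C)) q x := by
  rcases h with h | h
  · exact h.mul_eq_mul hq hAB hBC x
  · rw [Finset.union_comm A B, h.mul_eq_mul hq hAB.symm hAC x, mul_comm]

end Sums

section Separation

variable {Vt : Type}

/-- An m-connecting walk that has left an ancestrally closed set containing `C` along an
arrowhead never comes back. -/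
lemma not_mem_of_walk_of_arrowhead {M : MixedGraph Vt} {C : Finset Vt} {B : Set Vt}
    (hB : ∀ a b, M.dir a b → b ∈ B → a ∈ B) (hC : ∀ c ∈ C, c ∈ B) {b : Vt} :
    ∀ (p : List (Step Vt)) (s : Step Vt), s.htgt = true → s.tgt ∉ B →
      IsWalk M s.tgt p b → List.IsChain (jointOK M C) (s :: p) → b ∉ B
  | [], s, _, hs, hw, _ => by
    have : s.tgt = b := hw
    exact this ▸ hs
  | t :: p, s, hst, hs, hw, hc => by
    obtain ⟨hsrc, hin, hw⟩ := hw
    rw [List.isChain_cons_cons] at hc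
    obtain ⟨hj, hc⟩ := hc
    rcases hj with ⟨-, c, hcC, hcr⟩ | ⟨hnc, -⟩
    · refine absurd ?_ hs
      have : ∀ z, Relation.ReflTransGen M.dir z c → z ∈ B := by
        intro z hz
        induction hz using Relation.ReflTransGen.head_induction_on with
        | refl => exact hC c hcC
        | head h _ ih => exact hB _ _ h ih
      exact this _ hcr
    · have htail : t.hsrc = false := by
        by_contra h
        exact hnc ⟨hst, by simpa using h⟩
      rcases hin with ⟨-, ht, hd⟩ | ⟨h, -, -⟩ | ⟨h, -, -⟩
      · refine not_mem_of_walk_of_arrowhead hB hC p t ht (fun hB' => hs ?_) hw hc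
        exact hsrc ▸ hB _ _ hd hB'
      · simp [h] at htail
      · simp [h] at htail

/-- If `B` is ancestrally closed, `v` has no child in `B`, and `C ⊆ B` contains the remainder and
all parents of a set `Δ ∋ v` that is closed under bidirected edges within `B`, then `C`
separates `v` from every other vertex of `B`. -/
lemma not_mConn_of_district {M : MixedGraph Vt} {C : Finset Vt} {B Δ : Set Vt} {v b : Vt}
    (hB : ∀ a b, M.dir a b → b ∈ B → a ∈ B) (hC : ∀ c ∈ C, c ∈ B)
    (hbi : ∀ a ∈ Δ, ∀ b ∈ B, M.bi a b → b ∈ Δ)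
    (hΔC : ∀ a ∈ Δ, a ≠ v → a ∈ C) (hpa : ∀ a, ∀ d ∈ Δ, M.dir a d → a ∈ C)
    (hch : ∀ c, M.dir v c → c ∉ B) (hv : v ∈ Δ)
    (hbB : b ∈ B) (hbC : b ∉ C) (hbv : b ≠ v) : ¬ MConn M C v b := by
  have main : ∀ (p : List (Step Vt)) (u : Vt), u ∈ Δ →
      (∀ t, p.head? = some t → u ≠ v → t.hsrc = true) →
      IsWalk M u p b → List.IsChain (jointOK M C) p → False := by
    intro p
    induction p with
    | nil =>
      intro u hu _ hw _
      have hub : u = b := hw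
      subst hub
      exact hbC (hΔC u hu hbv)
    | cons t p ih =>
      intro u hu hhead hw hc
      obtain ⟨hsrc, hin, hw⟩ := hw
      subst hsrc
      rcases hin with ⟨h1, h2, hd⟩ | ⟨h1, h2, hd⟩ | ⟨h1, h2, hd⟩
      · have huv : t.src = v := by
          by_contra h
          simpa [h1] using hhead t rfl h
        exact not_mem_of_walk_of_arrowhead hB hC p t h2 (hch _ (huv ▸ hd)) hw hc hbB
      · have hmem : t.tgt ∈ C := hpa _ _ hu hd
        cases p with
        | nil =>
          have hub : t.tgt = b := hw
          exact hbC (hub ▸ hmem)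
        | cons t' p =>
          rw [List.isChain_cons_cons] at hc
          rcases hc.1 with ⟨⟨h, -⟩, -⟩ | ⟨-, h⟩
          · simp [h2] at h
          · exact h hmem
      · by_cases htB : t.tgt ∈ B
        · have htΔ := hbi _ hu _ htB hd
          refine ih t.tgt htΔ ?_ hw hc.tail
          intro t' ht' hne
          cases p with
          | nil => simp at ht'
          | cons t'' p =>
            simp only [List.head?_cons, Option.some.injEq] at ht'
            subst ht'
            rw [List.isChain_cons_cons] at hc
            rcases hc.1 with ⟨⟨-, h⟩, -⟩ | ⟨-, h⟩
            · exact h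
            · exact absurd (hΔC _ htΔ hne) h
        · exact not_mem_of_walk_of_arrowhead hB hC p t h2 htB hw hc hbB
  rintro ⟨p, hw, -, hc⟩
  exact main p v hv (fun _ _ h => absurd rfl h) hw hc

end Separation

section Graphs

variable {Vt : Type} [DecidableEq Vt] {G : PreCADMG Vt} {r s : Vt}

lemma PreCADMG.WF.fixG (hG : G.WF) : (fixG G r).WF := by
  obtain ⟨h1, h2, h3, h4, h5⟩ := hG
  refine ⟨?_, ?_, ?_, ?_, ?_⟩
  · rw [Finset.disjoint_left] at h1 ⊢
    intro a ha
    simp only [Nested.fixG, mem_erase, mem_insert] at ha ⊢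
    have := h1 ha.2
    tauto
  · rintro a b ⟨h, ha, hb⟩
    exact ⟨h2 _ _ h, hb, ha⟩
  · rintro a b ⟨h, hb⟩
    have := h3 _ _ h
    simp only [Nested.fixG, mem_union, mem_erase, mem_insert] at this ⊢
    tauto
  · rintro a b ⟨h, ha, hb⟩
    have := h4 _ _ h
    simp only [Nested.fixG, mem_erase]
    tauto
  · intro v hv
    exact h5 v (Relation.TransGen.mono (fun a b h => h.1) _ _ hv)

lemma dis_fixG_subset : dis (fixG G r) s ⊆ dis G s := by
  intro w hw
  obtain ⟨h1, h2⟩ := mem_filter.mp hw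
  exact mem_filter.mpr
    ⟨mem_of_mem_erase h1, Relation.ReflTransGen.mono (fun a b h => h.1) _ _ h2⟩

lemma verts_fixG (hr : r ∈ G.V) : (fixG G r).V ∪ (fixG G r).W = G.V ∪ G.W := by
  ext a
  simp only [fixG, mem_union, mem_erase, mem_insert]
  by_cases h : a = r <;> simp_all

lemma deF_fixG_subset (hr : r ∈ G.V) : deF (fixG G r) s ⊆ deF G s := by
  intro w hw
  rw [deF, verts_fixG hr, mem_filter] at hw
  rw [deF, mem_filter]
  exact ⟨hw.1, Relation.ReflTransGen.mono (fun a b h => h.1) _ _ hw.2⟩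

lemma mb_fixG_subset (hr : r ∈ G.V) : mb (fixG G r) s ⊆ mb G s := by
  intro w hw
  rw [mb, mem_union, paS, verts_fixG hr, mem_filter, mem_erase] at hw
  rw [mb, mem_union, paS, mem_filter, mem_erase]
  rcases hw with ⟨h, d, hd, hdir⟩ | ⟨h, hd⟩
  · exact Or.inl ⟨h, d, dis_fixG_subset hd, hdir.1⟩
  · exact Or.inr ⟨h, dis_fixG_subset hd⟩

lemma mem_dis_self (hs : s ∈ G.V) : s ∈ dis G s :=
  mem_filter.mpr ⟨hs, .refl⟩

lemma mem_deF_self (hs : s ∈ G.V) : s ∈ deF G s :=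
  mem_filter.mpr ⟨mem_union_left _ hs, .refl⟩

lemma fixable.fixG (hs : fixable G s) (hr : r ∈ G.V) (hsr : s ≠ r) : fixable (fixG G r) s := by
  have hV : s ∈ (Nested.fixG G r).V := mem_erase.mpr ⟨hsr, hs.1⟩
  refine ⟨hV, Finset.Subset.antisymm ?_ ?_⟩
  · rw [← hs.2]
    exact Finset.inter_subset_inter dis_fixG_subset (deF_fixG_subset hr)
  · rw [Finset.singleton_subset_iff]
    exact mem_inter.mpr ⟨mem_dis_self hV, mem_deF_self hV⟩

lemma fixG_comm : fixG (fixG G r) s = fixG (fixG G s) r := by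
  unfold fixG
  congr 1
  · funext a b
    exact propext (by tauto)
  · funext a b
    exact propext (by tauto)
  · exact Finset.erase_right_comm
  · exact Finset.insert_comm _ _ _

lemma deF_subset (hG : G.WF) (hs : s ∈ G.V) : deF G s ⊆ G.V := by
  intro w hw
  rcases Relation.ReflTransGen.cases_tail (mem_filter.mp hw).2 with h | ⟨c, -, h⟩
  · exact h ▸ hs
  · exact (hG.2.2.1 _ _ h).2

lemma mem_deF_of_dir (hG : G.WF) {a b : Vt} (h : G.dir a b) (ha : a ∈ deF G s) :
    b ∈ deF G s :=
  mem_filter.mpr ⟨mem_union_left _ (hG.2.2.1 _ _ h).2, (mem_filter.mp ha).2.tail h⟩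

lemma ne_of_dir_of_mem_deF (hG : G.WF) {a b : Vt} (h : G.dir a b) (ha : a ∈ deF G s) :
    b ≠ s := by
  rintro rfl
  exact hG.2.2.2.2 _ (Relation.TransGen.tail' (mem_filter.mp ha).2 h)

lemma deF_subset_deF (hs : s ∈ deF G r) : deF G s ⊆ deF G r := fun _ hw =>
  mem_filter.mpr ⟨(mem_filter.mp hw).1, (mem_filter.mp hs).2.trans (mem_filter.mp hw).2⟩

lemma notMem_deF_of_mem_deF (hG : G.WF) (hrs : r ≠ s) (hs : s ∈ deF G r) : r ∉ deF G s := by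
  intro hr
  rcases Relation.ReflTransGen.cases_tail (mem_filter.mp hr).2 with h | ⟨c, hc, h⟩
  · exact hrs h
  · exact hG.2.2.2.2 r (Relation.TransGen.tail' ((mem_filter.mp hs).2.trans hc) h)

lemma fixable.eq_of_mem (hs : fixable G s) {d : Vt} (h1 : d ∈ dis G s) (h2 : d ∈ deF G s) :
    d = s := by
  have : d ∈ dis G s ∩ deF G s := mem_inter.mpr ⟨h1, h2⟩
  rwa [hs.2, mem_singleton] at this

lemma fixable.disjoint_deF_mb (hG : G.WF) (hs : fixable G s) : Disjoint (deF G s) (mb G s) := by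
  rw [Finset.disjoint_left]
  intro a ha hm
  rw [mb, mem_union, mem_erase] at hm
  rcases hm with hm | ⟨hne, hm⟩
  · obtain ⟨-, d, hd, hdir⟩ := mem_filter.mp hm
    exact ne_of_dir_of_mem_deF hG hdir ha (hs.eq_of_mem hd (mem_deF_of_dir hG hdir ha))
  · exact hne (hs.eq_of_mem hm ha)

lemma dis_eq_of_mem (hG : G.WF) (h : r ∈ dis G s) : dis G s = dis G r := by
  have hsr := (mem_filter.mp h).2
  have hrs : Relation.ReflTransGen G.bi r s := by
    have : Std.Symm G.bi := ⟨hG.2.1⟩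
    exact symm_of (Relation.ReflTransGen G.bi) hsr
  ext a
  simp only [dis, mem_filter]
  exact ⟨fun ⟨h1, h2⟩ => ⟨h1, hrs.trans h2⟩, fun ⟨h1, h2⟩ => ⟨h1, hsr.trans h2⟩⟩

end Graphs

section Kernels

variable {Vt : Type} [Fintype Vt] [DecidableEq Vt] {𝔛 : Vt → Type} [∀ v, Fintype (𝔛 v)]
  {G : PreCADMG Vt} {q : (∀ v, 𝔛 v) → ℝ} {r s : Vt}

/-- Under the global Markov property, after summing out a descendant-closed set `Y` containing the
children of `v`, the conditional kernel of `v` does not involve vertices outside the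
Markov blanket of `v`. -/
lemma Pcm.sumOver_mul_sumOver (hG : G.WF) (hq : ∀ x, 0 ≤ q x) (hP : Pcm G q) {v : Vt}
    {Y E : Finset Vt} (hv : v ∈ G.V) (hYV : Y ⊆ G.V) (hEV : E ⊆ G.V) (hvY : v ∉ Y) (hvE : v ∉ E)
    (hY : ∀ a b, G.dir a b → a ∈ Y → b ∈ Y) (hch : ∀ c, G.dir v c → c ∈ Y)
    (hE : ∀ e ∈ E, e ∉ Y → e ∉ dis G v ∧ ∀ d ∈ dis G v, d ∉ Y → ¬ G.dir e d)
    (x : ∀ v, 𝔛 v) :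
    sumOver Y q x * sumOver (insert v (Y ∪ E)) q x =
      sumOver (insert v Y) q x * sumOver (Y ∪ E) q x := by
  obtain ⟨g1, g2, g3, g4, g5⟩ := id hG
  have hd := Finset.disjoint_left.mp g1
  set C := (G.V ∪ G.W) \ insert v (Y ∪ E) with hCdef
  have hAB : Disjoint ({v} : Finset Vt) (E \ Y) := by
    rw [Finset.disjoint_singleton_left]
    grind
  have hAC : Disjoint ({v} : Finset Vt) C := by
    rw [Finset.disjoint_singleton_left]
    grind
  have hBC : Disjoint (E \ Y) C := Finset.disjoint_left.mpr (by grind)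
  have hsep : MSep (augMG G) {v} (E \ Y) C := by
    intro a ha b hb
    rw [mem_singleton] at ha
    subst ha
    rw [mem_sdiff] at hb
    refine not_mConn_of_district (B := {z | z ∉ Y}) (Δ := {z | z ∈ dis G a ∧ z ∉ Y})
      ?_ ?_ ?_ ?_ ?_ ?_ ?_ hb.2 ?_ ?_
    · exact fun a b h hb ha => hb (hY a b h ha)
    · intro c hc
      simp only [Set.mem_setOf_eq]
      grind
    · rintro z ⟨hz, hzY⟩ w hw hbi
      rw [dis, mem_filter] at hz
      rcases hbi with hbi | ⟨hzW, -⟩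
      · exact ⟨mem_filter.mpr ⟨(g4 _ _ hbi).2, hz.2.tail hbi⟩, hw⟩
      · exact absurd hzW (hd hz.1)
    · rintro z ⟨hz, hzY⟩ hza
      have hzV := (mem_filter.mp hz).1
      have : z ∉ E := fun h => (hE z h hzY).1 hz
      grind
    · rintro z d ⟨hdd, hdY⟩ hdir
      have hzY : z ∉ Y := fun h => hdY (hY _ _ hdir h)
      have hza : z ≠ a := by
        rintro rfl
        exact hdY (hch _ hdir)
      have hzE : z ∉ E := fun h => (hE z h hzY).2 d hdd hdY hdir
      have hz := (g3 _ _ hdir).1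
      simp only [Finset.mem_union] at hz
      exact mem_sdiff.mpr ⟨mem_union.mpr hz, by simp [hza, hzY, hzE]⟩
    · exact fun c hc h => h (hch c hc)
    · exact ⟨mem_dis_self hv, hvY⟩
    · exact fun h => Finset.disjoint_left.mp hBC (mem_sdiff.mpr hb) h
    · rintro rfl
      exact hvE hb.1
  have hK := hP {v} (E \ Y) C (by grind) (by grind) (by grind) hAB hAC hBC hsep
  have := hK.mul_eq_mul hq hAB hAC hBC x
  have e1 : G.V \ ({v} ∪ E \ Y ∪ C) = Y := by ext z; have := @hd z; grind
  have e2 : G.V \ C = insert v (Y ∪ E) := by ext z; have := @hd z; grind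
  have e3 : G.V \ (E \ Y ∪ C) = insert v Y := by ext z; have := @hd z; grind
  have e4 : G.V \ ({v} ∪ C) = Y ∪ E := by ext z; have := @hd z; grind
  rwa [e1, e2, e3, e4] at this

lemma condOn_nonneg (hq : ∀ x, 0 ≤ q x) (V T : Finset Vt) (d : Vt) (x : ∀ v, 𝔛 v) :
    0 ≤ condOn V q d T x :=
  div_nonneg (sumOver_nonneg hq _ _) (sumOver_nonneg hq _ _)

lemma condOn_pos (hq : ∀ x, 0 ≤ q x) (V T : Finset Vt) (d : Vt) {x : ∀ v, 𝔛 v} (hx : 0 < q x) :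
    0 < condOn V q d T x :=
  div_pos (sumOver_pos_of_pos hq _ hx) (sumOver_pos_of_pos hq _ hx)

lemma fixK_nonneg (hq : ∀ x, 0 ≤ q x) (x : ∀ v, 𝔛 v) : 0 ≤ fixK G r q x :=
  div_nonneg (hq x) (condOn_nonneg hq _ _ _ x)

lemma fixK_pos_iff (hq : ∀ x, 0 ≤ q x) {x : ∀ v, 𝔛 v} : 0 < fixK G r q x ↔ 0 < q x := by
  refine ⟨fun h => ?_, fun h => div_pos h (condOn_pos hq _ _ _ h)⟩
  refine lt_of_le_of_ne (hq x) fun h0 => ?_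
  simp [fixK, ← h0] at h

lemma sumOver_fixK_pos_iff (hq : ∀ x, 0 ≤ q x) {S : Finset Vt} {x : ∀ v, 𝔛 v} :
    0 < sumOver S (fixK G r q) x ↔ 0 < sumOver S q x := by
  rw [sumOver_pos_iff (fixK_nonneg hq), sumOver_pos_iff hq]
  simp only [fixK_pos_iff hq]

/-- The conditional kernel of a fixable vertex given its Markov blanket agrees with the one given
the complement of any set of random vertices that contains its descendants and avoids its
Markov blanket. -/
lemma condOn_mul_sumOver (hG : G.WF) (hq : ∀ x, 0 ≤ q x) (hP : Pcm G q) (hs : fixable G s)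
    {H : Finset Vt} (hDH : deF G s ⊆ H) (hHV : H ⊆ G.V) (hHmb : Disjoint H (mb G s))
    {x : ∀ v, 𝔛 v} (hx : 0 < q x) :
    condOn G.V q s (mb G s) x * sumOver H q x = sumOver (H.erase s) q x := by
  have hsD := mem_deF_self hs.1
  have key : ∀ K : Finset Vt, deF G s ⊆ K → K ⊆ G.V → Disjoint K (mb G s) →
      sumOver ((deF G s).erase s) q x * sumOver K q x =
        sumOver (deF G s) q x * sumOver (K.erase s) q x := by
    intro K hDK hKV hK
    have := hP.sumOver_mul_sumOver hG hq (v := s) (Y := (deF G s).erase s) (E := K \ deF G s)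
      hs.1 ((Finset.erase_subset _ _).trans (deF_subset hG hs.1))
      (Finset.sdiff_subset.trans hKV) (Finset.notMem_erase _ _) (by grind)
      (fun a b h ha => mem_erase.mpr ⟨ne_of_dir_of_mem_deF hG h (mem_of_mem_erase ha),
        mem_deF_of_dir hG h (mem_of_mem_erase ha)⟩)
      (fun c h => mem_erase.mpr ⟨ne_of_dir_of_mem_deF hG h hsD, mem_deF_of_dir hG h hsD⟩)
      (fun e he _ => by
        rw [mem_sdiff] at he
        have hemb := Finset.disjoint_left.mp hK he.1
        rw [mb, mem_union, not_or, mem_erase] at hemb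
        refine ⟨fun h => hemb.2 ⟨?_, h⟩, fun d hd _ hdir => hemb.1 ?_⟩
        · rintro rfl
          exact he.2 hsD
        · exact mem_filter.mpr ⟨mem_union_left _ (hKV he.1), d, hd, hdir⟩) x
    have e1 : insert s ((deF G s).erase s ∪ K \ deF G s) = K := by
      ext z
      have := @hDK z
      grind
    have e2 : (deF G s).erase s ∪ K \ deF G s = K.erase s := by
      ext z
      have := @hDK z
      grind
    rwa [e1, e2, Finset.insert_erase hsD] at this
  have h1 := key H hDH hHV hHmb
  have hDmb := hs.disjoint_deF_mb hG
  have h2 := key (G.V \ mb G s)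
    (fun z hz => mem_sdiff.mpr ⟨deF_subset hG hs.1 hz, Finset.disjoint_left.mp hDmb hz⟩)
    Finset.sdiff_subset Finset.sdiff_disjoint
  have e : (G.V \ mb G s).erase s = G.V \ insert s (mb G s) := by grind
  rw [e] at h2
  have p1 := sumOver_pos_of_pos hq (deF G s) hx
  have p2 := sumOver_pos_of_pos hq (G.V \ mb G s) hx
  have hc : condOn G.V q s (mb G s) x =
      sumOver ((deF G s).erase s) q x / sumOver (deF G s) q x := by
    rw [condOn, div_eq_div_iff p2.ne' p1.ne']
    linarith
  rw [hc, div_mul_eq_mul_div, h1, mul_div_cancel_left₀ _ p1.ne']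

/-- Since the fixed vertex `r` is independent of its non-descendants after fixing, any value
of `r` with positive mass is compatible with any state of its non-descendants with positive mass. -/
lemma sumOver_erase_deF_pos (hG : G.WF) (hq : ∀ x, 0 ≤ q x)
    (hP' : Pcm (fixG G r) (fixK G r q)) (hr : r ∈ G.V) {x : ∀ v, 𝔛 v}
    (hx : 0 < sumOver (G.V.erase r) q x) (hD : 0 < sumOver (deF G r) q x) :
    0 < sumOver ((deF G r).erase r) q x := by
  obtain ⟨g1, g2, g3, g4, g5⟩ := id hG
  have hd := Finset.disjoint_left.mp g1
  have hrD := mem_deF_self hr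
  have hDV := deF_subset hG hr
  have hrW : r ∉ G.W := hd hr
  have hAB : Disjoint ({r} : Finset Vt) (G.V \ deF G r) := by
    rw [Finset.disjoint_singleton_left]
    grind
  have hAC : Disjoint ({r} : Finset Vt) G.W := Finset.disjoint_singleton_left.mpr hrW
  have hBC : Disjoint (G.V \ deF G r) G.W := g1.mono_left Finset.sdiff_subset
  have hsep : MSep (augMG (fixG G r)) {r} (G.V \ deF G r) G.W := by
    intro a ha b hb
    rw [mem_singleton] at ha
    subst ha
    rw [mem_sdiff] at hb
    refine not_mConn_of_district (B := {z | z ∉ (deF G a).erase a}) (Δ := {z | z = a ∨ z ∈ G.W})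
      ?_ ?_ ?_ ?_ ?_ ?_ (Or.inl rfl) ?_ (hd hb.1) ?_
    · rintro y z ⟨h, hza⟩ hz hy
      exact hz (mem_erase.mpr ⟨hza, mem_deF_of_dir hG h (mem_of_mem_erase hy)⟩)
    · exact fun c hc h => hd (hDV (mem_of_mem_erase h)) hc
    · rintro y hy z - (⟨hbi, hya, -⟩ | ⟨-, hz, -⟩)
      · rcases hy with hy | hy
        · exact absurd hy hya
        · exact absurd hy (hd (g4 _ _ hbi).1)
      · exact mem_insert.mp hz
    · rintro y (hy | hy) hne
      · exact absurd hy hne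
      · exact hy
    · rintro y d (hda | hdW) ⟨hdir, hne⟩
      · exact absurd hda hne
      · exact absurd hdW (hd (g3 _ _ hdir).2)
    · rintro c ⟨hdir, hne⟩ h
      exact h (mem_erase.mpr ⟨hne, mem_deF_of_dir hG hdir hrD⟩)
    · exact fun h => hb.2 (mem_of_mem_erase h)
    · rintro rfl
      exact hb.2 hrD
  have hU := verts_fixG hr
  have hK := hP' {r} (G.V \ deF G r) G.W (by rw [hU]; grind) (by rw [hU]; grind)
    (by rw [hU]; grind) hAB hAC hBC hsep
  have hV' : (fixG G r).V = G.V.erase r := rfl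
  have hW' : (fixG G r).W = insert r G.W := rfl
  rcases hK with hK | hK
  · have := hK.1
    rw [hW', Finset.singleton_inter_of_mem (mem_insert_self _ _)] at this
    exact absurd this (Finset.singleton_ne_empty r)
  · obtain ⟨y, hyx, hy⟩ := (sumOver_pos_iff hq).mp hD
    let z : ∀ v, 𝔛 v := Function.update x r (y r)
    have hzx : ∀ v, v ≠ r → z v = x v := fun v hv => Function.update_of_ne hv _ _
    have hzr : z r = y r := Function.update_self _ _ _
    have hzD : 0 < sumOver ((deF G r).erase r) q z := by
      refine (sumOver_pos_iff hq).mpr ⟨y, fun v hv => ?_, hy⟩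
      by_cases h : v = r
      · subst h
        exact hzr.symm
      · rw [hzx v h]
        exact hyx v fun h' => hv (mem_erase.mpr ⟨h, h'⟩)
    have hzV : 0 < sumOver (G.V.erase r) q z :=
      sumOver_pos_mono hq (Finset.erase_subset_erase _ hDV) hzD
    have e1 : (fixG G r).V \ ({r} ∪ G.W) = G.V.erase r := by
      rw [hV']
      ext v
      have := @hd v
      grind
    have e2 : (fixG G r).V \ (G.V \ deF G r ∪ {r} ∪ G.W) = (deF G r).erase r := by
      rw [hV']
      ext v
      have := @hd v
      have := @hDV v
      grind
    have := hK.2 z x (fun v hv => hzx v (by rintro rfl; grind))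
    rw [e1, e2] at this
    have := this ((sumOver_fixK_pos_iff hq).mpr hzV) ((sumOver_fixK_pos_iff hq).mpr hx)
    have hpos : 0 < sumOver ((deF G r).erase r) (fixK G r q) z /
        sumOver (G.V.erase r) (fixK G r q) z :=
      div_pos ((sumOver_fixK_pos_iff hq).mpr hzD) ((sumOver_fixK_pos_iff hq).mpr hzV)
    rw [this] at hpos
    rw [← sumOver_fixK_pos_iff hq (G := G) (r := r)]
    refine lt_of_le_of_ne (sumOver_nonneg (fixK_nonneg hq) _ _) fun h0 => ?_
    rw [← h0, zero_div] at hpos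
    exact lt_irrefl _ hpos

lemma sumOver_erase_pos (hG : G.WF) (hq : ∀ x, 0 ≤ q x)
    (hP' : Pcm (fixG G r) (fixK G r q)) (hr : r ∈ G.V) {H : Finset Vt} (hDH : deF G r ⊆ H)
    (hHV : H ⊆ G.V) {x : ∀ v, 𝔛 v} (hx : 0 < sumOver (G.V.erase r) q x) (hH : 0 < sumOver H q x) :
    0 < sumOver (H.erase r) q x := by
  obtain ⟨y, hyx, hy⟩ := (sumOver_pos_iff hq).mp hH
  let z : ∀ v, 𝔛 v := fun v => if v ∈ H.erase r then y v else x v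
  have hzx : ∀ v, v ∉ H.erase r → z v = x v := fun v hv => if_neg hv
  have hzr : z r = x r := hzx r (Finset.notMem_erase _ _)
  have hzy : ∀ v, v ≠ r → z v = y v := by
    intro v hv
    by_cases h : v ∈ H
    · exact if_pos (mem_erase.mpr ⟨hv, h⟩)
    · rw [hzx v fun h' => h (mem_of_mem_erase h'), hyx v h]
  rw [← sumOver_congr_off q hzx]
  refine sumOver_pos_mono hq (Finset.erase_subset_erase _ hDH)
    (sumOver_erase_deF_pos hG hq hP' hr ?_ ?_)
  · rwa [sumOver_congr_off q fun v hv => hzx v fun h => hv (Finset.erase_subset_erase _ hHV h)]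
  · refine (sumOver_pos_iff hq).mpr ⟨y, fun v hv => (hzy v ?_).symm, hy⟩
    rintro rfl
    exact hv (mem_deF_self hr)

/-- Marginalizing the fixed kernel over a descendant-closed set `Z`: it is the marginal of `q`
divided by the conditional kernel of `r` given its non-descendants outside `Z`. -/
lemma sumOver_fixK (hG : G.WF) (hq : ∀ x, 0 ≤ q x) (hP : Pcm G q)
    (hP' : Pcm (fixG G r) (fixK G r q)) (hr : fixable G r) :
    ∀ (Z : Finset Vt), Z ⊆ G.V → r ∉ Z → (∀ a b, G.dir a b → a ∈ Z → b ∈ Z) →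
      ∀ x : ∀ v, 𝔛 v, 0 < sumOver (G.V.erase r) q x →
        sumOver Z (fixK G r q) x =
          sumOver Z q x * sumOver (Z ∪ deF G r) q x / sumOver ((Z ∪ deF G r).erase r) q x := by
  set D := deF G r with hDdef
  have hDV : D ⊆ G.V := deF_subset hG hr.1
  have hrD : r ∈ D := mem_deF_self hr.1
  intro Z
  induction Z using Finset.strongInduction with
  | H Z ih =>
  intro hZV hrZ hZ x hx
  rcases Z.eq_empty_or_nonempty with rfl | hne
  · simp only [sumOver_empty, Finset.empty_union]
    by_cases h0 : 0 < q x
    · have h := condOn_mul_sumOver hG hq hP hr subset_rfl hDV (hr.disjoint_deF_mb hG) h0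
      have hc := condOn_pos hq G.V (mb G r) r h0
      have p1 := sumOver_pos_of_pos hq D h0
      rw [fixK, ← h, mul_div_mul_right _ _ p1.ne']
    · simp [fixK, le_antisymm (not_lt.mp h0) (hq x)]
  obtain ⟨v, hvZ, hmin⟩ : ∃ v ∈ Z, ∀ a ∈ Z, ¬ G.dir a v := by
    have : IsTrans Vt (Relation.TransGen G.dir) := ⟨fun _ _ _ => Relation.TransGen.trans⟩
    have : Std.Irrefl (Relation.TransGen G.dir) := ⟨hG.2.2.2.2⟩
    obtain ⟨v, hv, h⟩ := (Finite.wellFounded_of_trans_of_irrefl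
      (Relation.TransGen G.dir)).has_min (Z : Set Vt) hne
    exact ⟨v, hv, fun a ha hav => h a ha (.single hav)⟩
  have hvr : v ≠ r := fun h => hrZ (h ▸ hvZ)
  set Y := Z.erase v with hYdef
  have hvY : v ∉ Y := Finset.notMem_erase _ _
  have hYV : Y ⊆ G.V := (Finset.erase_subset _ _).trans hZV
  have hrY : r ∉ Y := fun h => hrZ (mem_of_mem_erase h)
  have hZY : Z = {v} ∪ Y := by rw [hYdef, ← Finset.insert_eq, Finset.insert_erase hvZ]
  have hY : ∀ a b, G.dir a b → a ∈ Y → b ∈ Y := fun a b h ha =>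
    mem_erase.mpr ⟨by rintro rfl; exact hmin a (mem_of_mem_erase ha) h,
      hZ a b h (mem_of_mem_erase ha)⟩
  have hchv : ∀ c, G.dir v c → c ∈ Y := fun c h =>
    mem_erase.mpr ⟨by rintro rfl; exact hmin _ hvZ h, hZ _ _ h hvZ⟩
  have hdv : Disjoint {v} Y := Finset.disjoint_singleton_left.mpr hvY
  have hIH := ih Y (Finset.erase_ssubset hvZ) hYV hrY hY
  have hagree : ∀ y : ∀ v, 𝔛 v, (∀ w, w ∉ ({v} : Finset Vt) → y w = x w) →
      ∀ S : Finset Vt, v ∈ S → sumOver S q y = sumOver S q x := fun y hy S hS =>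
    sumOver_congr_off q fun w hw => hy w fun h => hw (mem_singleton.mp h ▸ hS)
  have hpos : ∀ y : ∀ v, 𝔛 v, (∀ w, w ∉ ({v} : Finset Vt) → y w = x w) →
      0 < sumOver (G.V.erase r) q y := fun y hy => by
    rwa [hagree y hy _ (mem_erase.mpr ⟨hvr, hZV hvZ⟩)]
  have hzero : ∀ {S T : Finset Vt} {y : ∀ v, 𝔛 v}, S ⊆ T → ¬ 0 < sumOver T q y →
      sumOver S q y = 0 := fun hST hT =>
    le_antisymm (not_lt.mp fun h => hT (sumOver_pos_mono hq hST h)) (sumOver_nonneg hq _ _)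
  have hYsub : Y ⊆ (Y ∪ D).erase r := fun a ha =>
    mem_erase.mpr ⟨by rintro rfl; exact hrY ha, mem_union_left _ ha⟩
  have hins : insert v Y = Z := Finset.insert_erase hvZ
  have hYD : Y ∪ D.erase r = (Y ∪ D).erase r := by
    rw [Finset.erase_union_distrib, Finset.erase_eq_of_notMem hrY]
  have hZD : insert v (Y ∪ D.erase r) = (Z ∪ D).erase r := by
    rw [← Finset.insert_union, hins, Finset.erase_union_distrib, Finset.erase_eq_of_notMem hrZ]
  have hmono : (Y ∪ D).erase r ⊆ (Z ∪ D).erase r :=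
    Finset.erase_subset_erase _ (Finset.union_subset_union_left (Finset.erase_subset _ _))
  by_cases hcase : v ∈ D ∨ r ∉ dis G v
  · have hterm : ∀ y : ∀ v, 𝔛 v, (∀ w, w ∉ ({v} : Finset Vt) → y w = x w) →
        sumOver Y (fixK G r q) y =
          sumOver (Z ∪ D) q x / sumOver ((Z ∪ D).erase r) q x * sumOver Y q y := by
      intro y hy
      rw [hIH y (hpos y hy), ← hagree y hy (Z ∪ D) (mem_union_left _ hvZ),
        ← hagree y hy ((Z ∪ D).erase r) (mem_erase.mpr ⟨hvr, mem_union_left _ hvZ⟩)]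
      by_cases hvD : v ∈ D
      · have : Y ∪ D = Z ∪ D := by
          rw [← hins, Finset.insert_union, Finset.insert_eq_of_mem (mem_union_right _ hvD)]
        rw [this]
        ring
      · have hrv : r ∉ dis G v := hcase.resolve_left hvD
        by_cases h0 : 0 < sumOver ((Y ∪ D).erase r) q y
        · have e3 : Y ∪ D.erase r ∪ {r} = Y ∪ D := by
            rw [Finset.union_assoc, Finset.union_comm _ {r}, ← Finset.insert_eq,
              Finset.insert_erase hrD]
          have e1 : insert v (Y ∪ D.erase r ∪ {r}) = Z ∪ D := by
            rw [e3, ← Finset.insert_union, hins]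
          have key := hP.sumOver_mul_sumOver hG hq (v := v) (Y := Y ∪ D.erase r) (E := {r})
            (hZV hvZ) (Finset.union_subset hYV ((Finset.erase_subset _ _).trans hDV))
            (Finset.singleton_subset_iff.mpr hr.1)
            (fun h => (mem_union.mp h).elim hvY fun h => hvD (mem_of_mem_erase h))
            (by simpa using hvr)
            (fun a b h ha => (mem_union.mp ha).elim (fun ha => mem_union_left _ (hY a b h ha))
              fun ha => mem_union_right _ (mem_erase.mpr
                ⟨ne_of_dir_of_mem_deF hG h (mem_of_mem_erase ha),
                  mem_deF_of_dir hG h (mem_of_mem_erase ha)⟩))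
            (fun c h => mem_union_left _ (hchv c h))
            (fun e he _ => by
              obtain rfl := mem_singleton.mp he
              refine ⟨hrv, fun d _ hd hdir => hd (mem_union_right _ (mem_erase.mpr ?_))⟩
              exact ⟨ne_of_dir_of_mem_deF hG hdir hrD, mem_deF_of_dir hG hdir hrD⟩) y
          rw [e1, hZD, e3, hYD] at key
          have h1 : 0 < sumOver ((Z ∪ D).erase r) q y :=
            sumOver_pos_mono hq hmono h0
          rw [mul_div_assoc, mul_comm (sumOver Y q y)]
          congr 1
          rw [div_eq_div_iff h0.ne' h1.ne']
          linarith
        · rw [hzero hYsub h0]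
          simp
    conv_lhs => rw [hZY]
    rw [sumOver_union hdv, sumOver_congr hterm, sumOver_const_mul, ← sumOver_union hdv, ← hZY]
    ring
  · push Not at hcase
    obtain ⟨hvD, hrv⟩ := hcase
    have hdis : dis G v = dis G r := dis_eq_of_mem hG hrv
    have hterm : ∀ y : ∀ v, 𝔛 v, (∀ w, w ∉ ({v} : Finset Vt) → y w = x w) →
        sumOver Y (fixK G r q) y =
          sumOver Z q x / sumOver ((Z ∪ D).erase r) q x * sumOver (Y ∪ D) q y := by
      intro y hy
      rw [hIH y (hpos y hy), ← hagree y hy Z hvZ,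
        ← hagree y hy ((Z ∪ D).erase r) (mem_erase.mpr ⟨hvr, mem_union_left _ hvZ⟩)]
      by_cases h0 : 0 < sumOver ((Y ∪ D).erase r) q y
      · have key := hP.sumOver_mul_sumOver hG hq (v := v) (Y := Y) (E := D.erase r)
          (hZV hvZ) hYV ((Finset.erase_subset _ _).trans hDV) hvY
          (fun h => hvD (mem_of_mem_erase h)) hY hchv
          (fun e he _ => by
            rw [hdis]
            obtain ⟨her, heD⟩ := mem_erase.mp he
            exact ⟨fun h => her (hr.eq_of_mem h heD), fun d hd _ hdir =>
              ne_of_dir_of_mem_deF hG hdir heD (hr.eq_of_mem hd (mem_deF_of_dir hG hdir heD))⟩) y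
        rw [hZD, hins, hYD] at key
        have h1 : 0 < sumOver ((Z ∪ D).erase r) q y :=
          sumOver_pos_mono hq hmono h0
        rw [div_mul_eq_mul_div, div_eq_div_iff h0.ne' h1.ne']
        linear_combination sumOver (Y ∪ D) q y * key
      · have h1 : ¬ 0 < sumOver (Y ∪ D) q y := fun h => h0
          (sumOver_erase_pos hG hq hP' hr.1 Finset.subset_union_right
            (Finset.union_subset hYV hDV) (hpos y hy) h)
        rw [hzero hYsub h0, hzero subset_rfl h1]
        simp
    have hdv' : Disjoint {v} (Y ∪ D) := by
      rw [Finset.disjoint_singleton_left]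
      exact fun h => (mem_union.mp h).elim hvY hvD
    have hZYD : Z ∪ D = {v} ∪ (Y ∪ D) := by rw [hZY, Finset.union_assoc]
    conv_lhs => rw [hZY]
    rw [sumOver_union hdv, sumOver_congr hterm, sumOver_const_mul, ← sumOver_union hdv', ← hZYD]
    ring

lemma condOn_fixK_mul_sumOver (hG : G.WF) (hq : ∀ x, 0 ≤ q x)
    (hP' : Pcm (fixG G r) (fixK G r q)) (hr : fixable G r) (hs : fixable G s) (hsr : s ≠ r)
    {H : Finset Vt} (hDH : deF (fixG G r) s ⊆ H) (hHV : H ⊆ G.V.erase r)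
    (hHmb : Disjoint H (mb G s)) {x : ∀ v, 𝔛 v} (hx : 0 < q x) :
    condOn (fixG G r).V (fixK G r q) s (mb (fixG G r) s) x * sumOver H (fixK G r q) x =
      sumOver (H.erase s) (fixK G r q) x :=
  condOn_mul_sumOver hG.fixG (fixK_nonneg hq) hP' (hs.fixG hr.1 hsr) hDH hHV
    (hHmb.mono_right (mb_fixG_subset hr.1)) ((fixK_pos_iff hq).mpr hx)

lemma condOn_fixK_eq_of_mem_deF (hG : G.WF) (hq : ∀ x, 0 ≤ q x) (hP : Pcm G q)
    (hPr : Pcm (fixG G r) (fixK G r q)) (hr : fixable G r) (hs : fixable G s) (hrs : r ≠ s)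
    (hsr : s ∈ deF G r) {x : ∀ v, 𝔛 v} (hx : 0 < q x) :
    condOn (fixG G r).V (fixK G r q) s (mb (fixG G r) s) x = condOn G.V q s (mb G s) x := by
  have hrDs := notMem_deF_of_mem_deF hG hrs hsr
  have hDsD := deF_subset_deF hsr
  have hDsV := deF_subset hG hs.1
  have hsDs := mem_deF_self hs.1
  have hx' := sumOver_pos_of_pos hq (G.V.erase r) hx
  have c1 := condOn_mul_sumOver hG hq hP hs subset_rfl hDsV (hs.disjoint_deF_mb hG) hx
  have c2 := condOn_fixK_mul_sumOver hG hq hPr hr hs hrs.symm (deF_fixG_subset hr.1)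
    (fun a ha => mem_erase.mpr ⟨by rintro rfl; exact hrDs ha, hDsV ha⟩)
    (hs.disjoint_deF_mb hG) hx
  have s1 := sumOver_fixK hG hq hP hPr hr (deF G s) hDsV hrDs
    (fun a b h ha => mem_deF_of_dir hG h ha) x hx'
  have s2 := sumOver_fixK hG hq hP hPr hr ((deF G s).erase s)
    ((Finset.erase_subset _ _).trans hDsV) (fun h => hrDs (mem_of_mem_erase h))
    (fun a b h ha => mem_erase.mpr ⟨ne_of_dir_of_mem_deF hG h (mem_of_mem_erase ha),
      mem_deF_of_dir hG h (mem_of_mem_erase ha)⟩) x hx'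
  rw [Finset.union_eq_right.mpr hDsD] at s1
  rw [Finset.union_eq_right.mpr ((Finset.erase_subset _ _).trans hDsD)] at s2
  have p1 := sumOver_pos_of_pos hq (deF G s) hx
  have p2 := sumOver_pos_of_pos hq (deF G r) hx
  have p3 := sumOver_pos_of_pos hq ((deF G r).erase r) hx
  rw [s1, s2, ← c1] at c2
  field_simp at c2
  exact c2

lemma condOn_fixK_eq_of_mem_deF' (hG : G.WF) (hq : ∀ x, 0 ≤ q x) (hP : Pcm G q)
    (hPs : Pcm (fixG G s) (fixK G s q)) (hr : fixable G r) (hs : fixable G s) (hrs : r ≠ s)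
    (hsr : s ∈ deF G r) {x : ∀ v, 𝔛 v} (hx : 0 < q x) :
    condOn (fixG G s).V (fixK G s q) r (mb (fixG G s) r) x = condOn G.V q r (mb G r) x := by
  have hrDs := notMem_deF_of_mem_deF hG hrs hsr
  have hDsD := deF_subset_deF hsr
  have hDV := deF_subset hG hr.1
  have hDsV := deF_subset hG hs.1
  have hrD := mem_deF_self hr.1
  have hsDs := mem_deF_self hs.1
  have hmarg : ∀ y : ∀ v, 𝔛 v, 0 < sumOver (G.V.erase s) q y →
      sumOver ((deF G s).erase s) (fixK G s q) y = sumOver (deF G s) q y := by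
    intro y hy
    have h := sumOver_fixK hG hq hP hPs hs ((deF G s).erase s)
      ((Finset.erase_subset _ _).trans hDsV) (Finset.notMem_erase _ _)
      (fun a b h ha => mem_erase.mpr ⟨ne_of_dir_of_mem_deF hG h (mem_of_mem_erase ha),
        mem_deF_of_dir hG h (mem_of_mem_erase ha)⟩) y hy
    rw [Finset.union_eq_right.mpr (Finset.erase_subset _ _)] at h
    rw [h]
    by_cases h0 : 0 < sumOver (deF G s) q y
    · have := sumOver_erase_deF_pos hG hq hPs hs.1 hy h0
      field_simp
    · rw [le_antisymm (not_lt.mp h0) (sumOver_nonneg hq _ _)]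
      simp
  have hmarg' : ∀ K : Finset Vt, K ⊆ G.V → Disjoint K (deF G s) →
      sumOver (K ∪ (deF G s).erase s) (fixK G s q) x = sumOver (K ∪ deF G s) q x := by
    intro K hKV hK
    rw [sumOver_union hK, sumOver_union (hK.mono_right (Finset.erase_subset _ _))]
    refine sumOver_congr fun y hy => hmarg y ?_
    rw [sumOver_congr_off q fun v hv => hy v fun h => hv (mem_erase.mpr ⟨?_, hKV h⟩)]
    · exact sumOver_pos_of_pos hq _ hx
    · rintro rfl
      exact Finset.disjoint_left.mp hK h hsDs
  have m1 := hmarg' (deF G r \ deF G s) (Finset.sdiff_subset.trans hDV) Finset.sdiff_disjoint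
  have m2 := hmarg' ((deF G r \ deF G s).erase r)
    ((Finset.erase_subset _ _).trans (Finset.sdiff_subset.trans hDV))
    (Finset.sdiff_disjoint.mono_left (Finset.erase_subset _ _))
  have e1 : deF G r \ deF G s ∪ (deF G s).erase s = (deF G r).erase s := by
    ext z; have := @hDsD z; grind
  have e2 : deF G r \ deF G s ∪ deF G s = deF G r := Finset.sdiff_union_of_subset hDsD
  have e3 : (deF G r \ deF G s).erase r ∪ (deF G s).erase s = ((deF G r).erase s).erase r := by
    ext z; have := @hDsD z; grind
  have e4 : (deF G r \ deF G s).erase r ∪ deF G s = (deF G r).erase r := by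
    ext z; have := @hDsD z; grind
  rw [e1, e2] at m1
  rw [e3, e4] at m2
  have c1 := condOn_mul_sumOver hG hq hP hr subset_rfl hDV (hr.disjoint_deF_mb hG) hx
  have c2 := condOn_fixK_mul_sumOver hG hq hPs hs hr hrs (H := (deF G r).erase s)
    (fun a ha => mem_erase.mpr ⟨?_, deF_fixG_subset hs.1 ha⟩)
    (Finset.erase_subset_erase _ hDV)
    ((hr.disjoint_deF_mb hG).mono_left (Finset.erase_subset _ _)) hx
  · rw [m1, m2, ← c1] at c2
    exact mul_right_cancel₀ (sumOver_pos_of_pos hq (deF G r) hx).ne' c2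
  · rintro rfl
    rcases Relation.ReflTransGen.cases_tail (mem_filter.mp ha).2 with h | ⟨c, -, h⟩
    · exact hrs h.symm
    · exact h.2 rfl

/-- If neither of `r`, `s` is a descendant of the other, then the product of the two divisors used
to fix `r` and then `s` is symmetric in `r` and `s`. -/
lemma condOn_mul_condOn_fixK (hG : G.WF) (hq : ∀ x, 0 ≤ q x) (hP : Pcm G q)
    (hPr : Pcm (fixG G r) (fixK G r q)) (hr : fixable G r) (hs : fixable G s) (hrs : r ≠ s)
    (hrDs : r ∉ deF G s) (hsDr : s ∉ deF G r) {x : ∀ v, 𝔛 v} (hx : 0 < q x) :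
    condOn G.V q r (mb G r) x *
      condOn (fixG G r).V (fixK G r q) s (mb (fixG G r) s) x =
    sumOver ((deF G r).erase r) q x * sumOver ((deF G s).erase s) q x /
        (sumOver (deF G r) q x * sumOver (deF G s) q x) *
      (sumOver ((deF G s).erase s ∪ deF G r) q x * sumOver ((deF G r).erase r ∪ deF G s) q x /
        (sumOver ((deF G r).erase r ∪ (deF G s).erase s) q x *
          sumOver (deF G r ∪ deF G s) q x)) := by
  have hDsV := deF_subset hG hs.1
  have hrE : r ∉ (deF G s).erase s := fun h => hrDs (mem_of_mem_erase h)
  have hx' := sumOver_pos_of_pos hq (G.V.erase r) hx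
  have c1 := condOn_mul_sumOver hG hq hP hr subset_rfl (deF_subset hG hr.1)
    (hr.disjoint_deF_mb hG) hx
  have c2 := condOn_fixK_mul_sumOver hG hq hPr hr hs hrs.symm (deF_fixG_subset hr.1)
    (fun a ha => mem_erase.mpr ⟨by rintro rfl; exact hrDs ha, hDsV ha⟩)
    (hs.disjoint_deF_mb hG) hx
  have s1 := sumOver_fixK hG hq hP hPr hr (deF G s) hDsV hrDs
    (fun a b h ha => mem_deF_of_dir hG h ha) x hx'
  have s2 := sumOver_fixK hG hq hP hPr hr ((deF G s).erase s)
    ((Finset.erase_subset _ _).trans hDsV) hrE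
    (fun a b h ha => mem_erase.mpr ⟨ne_of_dir_of_mem_deF hG h (mem_of_mem_erase ha),
      mem_deF_of_dir hG h (mem_of_mem_erase ha)⟩) x hx'
  rw [Finset.erase_union_distrib, Finset.erase_eq_of_notMem hrDs,
    Finset.union_comm _ ((deF G r).erase r), Finset.union_comm _ (deF G r)] at s1
  rw [Finset.erase_union_distrib _ _ r, Finset.erase_eq_of_notMem hrE,
    Finset.union_comm _ ((deF G r).erase r)] at s2
  have hp := fun S => sumOver_pos_of_pos hq S hx
  rw [s1, s2] at c2
  have p1 := hp (deF G r)
  have p2 := hp (deF G s)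
  have p3 := hp ((deF G r).erase r ∪ deF G s)
  have p4 := hp (deF G r ∪ deF G s)
  have p5 := hp ((deF G r).erase r ∪ (deF G s).erase s)
  rw [← c1]
  field_simp
  field_simp at c2
  linear_combination condOn G.V q r (mb G r) x * c2

/-- Fixing operations on kernels commute. -/
lemma fixK_comm (hG : G.WF) (hq : ∀ x, 0 ≤ q x) (hP : Pcm G q)
    (hPr : Pcm (fixG G r) (fixK G r q)) (hPs : Pcm (fixG G s) (fixK G s q))
    (hr : fixable G r) (hs : fixable G s) (hrs : r ≠ s) :
    fixK (fixG G r) s (fixK G r q) = fixK (fixG G s) r (fixK G s q) := by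
  funext x
  by_cases hx : 0 < q x
  · simp only [fixK, div_div]
    congr 1
    change condOn G.V q r (mb G r) x *
        condOn (fixG G r).V (fixK G r q) s (mb (fixG G r) s) x =
      condOn G.V q s (mb G s) x * condOn (fixG G s).V (fixK G s q) r (mb (fixG G s) r) x
    by_cases h1 : s ∈ deF G r
    · rw [condOn_fixK_eq_of_mem_deF hG hq hP hPr hr hs hrs h1 hx,
        condOn_fixK_eq_of_mem_deF' hG hq hP hPs hr hs hrs h1 hx, mul_comm]
    by_cases h2 : r ∈ deF G s
    · rw [condOn_fixK_eq_of_mem_deF hG hq hP hPs hs hr hrs.symm h2 hx,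
        condOn_fixK_eq_of_mem_deF' hG hq hP hPr hs hr hrs.symm h2 hx, mul_comm]
    · rw [condOn_mul_condOn_fixK hG hq hP hPr hr hs hrs h2 h1 hx,
        condOn_mul_condOn_fixK hG hq hP hPs hs hr hrs.symm h1 h2 hx]
      rw [Finset.union_comm (deF G s) (deF G r),
        Finset.union_comm ((deF G s).erase s) ((deF G r).erase r)]
      ring
  · simp [fixK, le_antisymm (not_lt.mp hx) (hq x)]

end Kernels

section Sequences

variable {Vt : Type} [Fintype Vt] [DecidableEq Vt] {𝔛 : Vt → Type} [∀ v, Fintype (𝔛 v)]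

lemma NestedGlobal.pcm {G : PreCADMG Vt} {q : (∀ v, 𝔛 v) → ℝ} (h : NestedGlobal G q) :
    Pcm G q := h [] trivial

lemma NestedGlobal.fix {G : PreCADMG Vt} {q : (∀ v, 𝔛 v) → ℝ} (h : NestedGlobal G q) {r : Vt}
    (hr : fixable G r) : NestedGlobal (fixG G r) (fixK G r q) :=
  fun ws hws => h (r :: ws) ⟨hr, hws⟩

/-- A vertex of a valid fixing sequence that is already fixable may be fixed first. -/
lemma move_to_front {r : Vt} {b : List Vt} :
    ∀ (a : List Vt) (G : PreCADMG Vt) (q : (∀ v, 𝔛 v) → ℝ), G.WF → (∀ x, 0 ≤ q x) →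
      NestedGlobal G q → ValidSeq G (a ++ r :: b) → fixable G r → r ∉ a →
      ValidSeq G (r :: (a ++ b)) ∧ fixGs G (a ++ r :: b) = fixGs G (r :: (a ++ b)) ∧
        fixKs G q (a ++ r :: b) = fixKs G q (r :: (a ++ b))
  | [], _, _, _, _, _, hv, _, _ => ⟨hv, rfl, rfl⟩
  | h :: a, G, q, hG, hq, hN, hv, hr, hra => by
    obtain ⟨hh, hv⟩ := hv
    rw [List.mem_cons, not_or] at hra
    obtain ⟨⟨-, h2⟩, h3, h4⟩ := move_to_front a (fixG G h) (fixK G h q) hG.fixG (fixK_nonneg hq)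
      (hN.fix hh) hv (hr.fixG hh.1 hra.1) hra.2
    have hK := fixK_comm hG hq hN.pcm (hN.fix hh).pcm (hN.fix hr).pcm hh hr (Ne.symm hra.1)
    refine ⟨⟨hr, hh.fixG hr.1 (Ne.symm hra.1), ?_⟩, ?_, ?_⟩
    · rw [fixG_comm]
      exact h2
    · simp only [List.cons_append, fixGs] at h3 ⊢
      rw [h3, fixG_comm]
    · simp only [List.cons_append, fixKs] at h4 ⊢
      rw [h4, fixG_comm, hK]

/-- The graph and the kernel reached by a valid fixing sequence depend only on the set of
fixed vertices. -/
lemma fix_eq_of_toFinset_eq :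
    ∀ (w u : List Vt) (G : PreCADMG Vt) (q : (∀ v, 𝔛 v) → ℝ), G.WF → (∀ x, 0 ≤ q x) →
      NestedGlobal G q → ValidSeq G u → ValidSeq G w → u.Nodup → w.Nodup →
      (∀ v, v ∈ u ↔ v ∈ w) → fixGs G u = fixGs G w ∧ fixKs G q u = fixKs G q w
  | [], u, _, _, _, _, _, _, _, _, _, h => by
    have : u = [] := List.eq_nil_iff_forall_not_mem.mpr fun v hv => by simpa using (h v).mp hv
    subst this
    exact ⟨rfl, rfl⟩
  | r :: w, u, G, q, hG, hq, hN, hu, hw, hun, hwn, h => by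
    obtain ⟨a, b, rfl⟩ := List.append_of_mem ((h r).mpr List.mem_cons_self)
    rw [List.nodup_middle, List.nodup_cons] at hun
    rw [List.nodup_cons] at hwn
    obtain ⟨hv, e1, e2⟩ := move_to_front a G q hG hq hN hu hw.1
      fun h => hun.1 (List.mem_append_left _ h)
    rw [e1, e2]
    refine fix_eq_of_toFinset_eq w (a ++ b) (fixG G r) (fixK G r q) hG.fixG (fixK_nonneg hq)
      (hN.fix hw.1) hv.2 hw.2 hun.2 hwn.2 fun v => ?_
    by_cases hvr : v = r
    · subst hvr
      exact iff_of_false hun.1 hwn.1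
    · have := h v
      simp only [List.mem_append, List.mem_cons, hvr, false_or] at this ⊢
      exact this

end Sequences

end Nested

open Nested in
/-- if `p(x_V)` obeys the global nested Markov property w.r.t.
an ADMG `𝒢(V)` and `u`, `w` are two valid fixing sequences for the same set
`W ⊂ V`, then `φ_u(𝒢) = φ_w(𝒢)` and `φ_u(p; 𝒢) = φ_w(p; 𝒢)`. -/
theorem fixing_order_invariance
    {Vt : Type} [Fintype Vt] [DecidableEq Vt]
    {𝔛 : Vt → Type} [∀ v, Fintype (𝔛 v)]
    (G : PreCADMG Vt) (hWF : G.WF) (hW : G.W = ∅)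
    (p : (∀ v, 𝔛 v) → ℝ) (hp : IsKernel G.V G.W p)
    (hnest : NestedGlobal G p)
    (u w : List Vt) (hu : ValidSeq G u) (hw : ValidSeq G w)
    (hun : u.Nodup) (hwn : w.Nodup)
    (hset : u.toFinset = w.toFinset) (hsub : u.toFinset ⊂ G.V) :
    fixGs G u = fixGs G w ∧ fixKs G p u = fixKs G p w := by
  exact fix_eq_of_toFinset_eq w u G p hWF hp.1 hnest hu hw hun hwn fun v => by
    rw [← List.mem_toFinset, hset, List.mem_toFinset]
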